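/- Let f = (V_1 ⊊ ⋯ ⊊ V_{n-1}) be a maximal flag in F^n with label σ, and let S be a proper subset of {1,…,n−1}. Then the flag g = {V_ℓ : ℓ ∈ {1,…,n−1} ∖ S}, obtained from f by deleting the subspaces V_ℓ with ℓ ∈ S, satisfies minlabel(g) = σ if and only if σ(t) < σ(t+1) for every t ∈ S. -/

import Mathlib

open Matrix

variable {n : ℕ} {F : Type} [Field F]

/-- `(r, j)` is a pivot position of `M`: the entry `M r j` is nonzero and all entries of
column `j` strictly below row `r` vanish (i.e. `r` is the largest row index with `M r j ≠ 0`). -/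
def IsPivot (M : Matrix (Fin n) (Fin n) F) (r j : Fin n) : Prop :=
  M r j ≠ 0 ∧ ∀ r' : Fin n, r < r' → M r' j = 0

/-- The span of the first `j` columns of `M` (columns with index `< j` in 0-based indexing). -/
def colSpan (M : Matrix (Fin n) (Fin n) F) (j : ℕ) : Submodule F (Fin n → F) :=
  Submodule.span F ((fun i : Fin n => Mᵀ i) '' {i : Fin n | (i : ℕ) < j})

/-- A flag: a nonempty finite set of proper nonzero subspaces of `F^n` forming a chain. -/
def IsFlag (g : Set (Submodule F (Fin n → F))) : Prop :=
  g.Finite ∧ g.Nonempty ∧ IsChain (· ≤ ·) g ∧ ∀ V ∈ g, V ≠ ⊥ ∧ V ≠ ⊤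

/-- A maximal flag: a flag containing a subspace of every dimension `1,…,n-1`. -/
def IsMaximalFlag (f : Set (Submodule F (Fin n → F))) : Prop :=
  IsFlag f ∧ ∀ j : ℕ, 1 ≤ j → j ≤ n - 1 → ∃ V ∈ f, Module.finrank F V = j

/-- Conditions (i)–(iii) for a matrix representation of a flag `f`:
(i) for every `V ∈ f` the first `dim V` columns of `M` span `V`, and all `n` columns span `F^n`;
(ii) every pivot entry equals `1`;
(iii) entries in the same row as a pivot and strictly to its right vanish. -/
def IsRep (f : Set (Submodule F (Fin n → F))) (M : Matrix (Fin n) (Fin n) F) : Prop :=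
  (∀ V ∈ f, colSpan M (Module.finrank F V) = V) ∧
  colSpan M n = ⊤ ∧
  (∀ r j : Fin n, IsPivot M r j → M r j = 1) ∧
  (∀ r j j' : Fin n, IsPivot M r j → j < j' → M r j' = 0)

/-- Columns `i` and `i'` lie in the same block of the block decomposition induced by the
flag `g` (blocks are the intervals of columns between consecutive dimensions of members of `g`). -/
def SameBlock (g : Set (Submodule F (Fin n → F))) (i i' : Fin n) : Prop :=
  ∀ V ∈ g, ((i : ℕ) < Module.finrank F V ↔ (i' : ℕ) < Module.finrank F V)

/-- The minimal matrix representation of a flag `g`: conditions (i)–(iii) together with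
(iv) within each block, entries in the same row as a pivot of the block and strictly to its left
within the block vanish; (v) within each block, pivot row indices strictly increase. -/
def IsMinRep (g : Set (Submodule F (Fin n → F))) (M : Matrix (Fin n) (Fin n) F) : Prop :=
  IsRep g M ∧
  (∀ r i i' : Fin n, SameBlock g i i' → IsPivot M r i → i' < i → M r i' = 0) ∧
  (∀ r r' i i' : Fin n, SameBlock g i i' → IsPivot M r i → IsPivot M r' i' → i < i' → r < r')

/-- `σ` is the label of the maximal flag `f`: `σ j` is the pivot row of the `j`-th column of
the minimal matrix representation of `f`. -/
def IsLabel (f : Set (Submodule F (Fin n → F))) (σ : Equiv.Perm (Fin n)) : Prop :=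
  ∃ M : Matrix (Fin n) (Fin n) F, IsRep f M ∧ ∀ j : Fin n, IsPivot M (σ j) j

/-- Strict lexicographic order on permutations in one-line notation `(σ 0, …, σ (n-1))`. -/
def LexLt {n : ℕ} (σ τ : Equiv.Perm (Fin n)) : Prop :=
  ∃ j : Fin n, (∀ i : Fin n, i < j → σ i = τ i) ∧ σ j < τ j

/-- `σ` is the lexicographically least label among the labels of maximal flags containing `g`. -/
def IsMinlabel (g : Set (Submodule F (Fin n → F))) (σ : Equiv.Perm (Fin n)) : Prop :=
  (∃ f, IsMaximalFlag f ∧ g ⊆ f ∧ IsLabel f σ) ∧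
  ∀ (f : Set (Submodule F (Fin n → F))) (τ : Equiv.Perm (Fin n)),
    IsMaximalFlag f → g ⊆ f → IsLabel f τ → σ = τ ∨ LexLt σ τ

/-- `t` is a (0-based) ascent of `σ`: `σ t < σ (t+1)`.  (In the 1-based indexing of the paper
this corresponds to the ascent `(σ(t+1), σ(t+2))` at position `t+1`.) -/
def Ascent {n : ℕ} (σ : Equiv.Perm (Fin n)) (t : ℕ) : Prop :=
  ∃ h : t + 1 < n, σ ⟨t, Nat.lt_of_succ_lt h⟩ < σ ⟨t + 1, h⟩

/-- `σ` is the decreasing permutation `σ(j) = n + 1 - j` (in 0-based indexing, `n - 1 - j`). -/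
def IsDecreasing {n : ℕ} (σ : Equiv.Perm (Fin n)) : Prop :=
  ∀ j : Fin n, (σ j : ℕ) = n - 1 - (j : ℕ)

theorem IsPivot.row_unique {M N : Matrix (Fin n) (Fin n) F} {r s j k : Fin n}
    (hr : IsPivot M r j) (hs : IsPivot N s k) (h : Mᵀ j = Nᵀ k) : r = s := by
  have h' : ∀ i, M i j = N i k := fun i => congrFun h i
  rcases lt_trichotomy r s with hlt | heq | hlt
  · exact absurd ((h' s).symm.trans (hr.2 s hlt)) hs.1
  · exact heq
  · exact absurd ((h' r).trans (hs.2 r hlt)) hr.1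

theorem col_mem_colSpan (M : Matrix (Fin n) (Fin n) F) {j : Fin n} {d : ℕ} (h : (j : ℕ) < d) :
    Mᵀ j ∈ colSpan M d :=
  Submodule.subset_span ⟨j, h, rfl⟩

theorem colSpan_le {M : Matrix (Fin n) (Fin n) F} {d : ℕ} {V : Submodule F (Fin n → F)}
    (h : ∀ j : Fin n, (j : ℕ) < d → Mᵀ j ∈ V) : colSpan M d ≤ V := by
  refine Submodule.span_le.2 ?_
  rintro _ ⟨j, hj, rfl⟩
  exact h j hj

theorem colSpan_mono (M : Matrix (Fin n) (Fin n) F) : Monotone (colSpan M) := fun _ _ h =>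
  colSpan_le fun _ hj => col_mem_colSpan M (hj.trans_le h)

theorem exists_coeff_of_mem_colSpan {M : Matrix (Fin n) (Fin n) F} {d : ℕ} {v : Fin n → F}
    (hv : v ∈ colSpan M d) :
    ∃ c : Fin n → F, (∀ i, c i ≠ 0 → (i : ℕ) < d) ∧ ∀ r, v r = ∑ i, c i * M r i := by
  classical
  induction hv using Submodule.span_induction with
  | mem x hx =>
    obtain ⟨j, hj, rfl⟩ := hx
    refine ⟨Pi.single j 1, fun i hi => ?_, fun r => ?_⟩
    · by_cases h : i = j
      · exact h ▸ hj
      · simp [h] at hi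
    · simp [Pi.single_apply]
  | zero => exact ⟨0, by simp, by simp⟩
  | add x y _ _ hx hy =>
    obtain ⟨a, ha, hax⟩ := hx
    obtain ⟨b, hb, hby⟩ := hy
    refine ⟨a + b, fun i hi => ?_, fun r => ?_⟩
    · by_cases h : a i = 0
      · exact hb i (by simpa [h] using hi)
      · exact ha i h
    · simp [hax, hby, add_mul, Finset.sum_add_distrib]
  | smul e x _ hx =>
    obtain ⟨a, ha, hax⟩ := hx
    refine ⟨e • a, fun i hi => ha i fun h => hi (by simp [h]), fun r => ?_⟩
    simp [hax, Finset.mul_sum, mul_assoc]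

/-- A nonzero vector in the span of columns with distinct pivots has its last nonzero entry
in the pivot row of one of these columns. -/
theorem exists_pivot_of_mem_colSpan {M : Matrix (Fin n) (Fin n) F} {σ : Equiv.Perm (Fin n)}
    (hM : ∀ j, IsPivot M (σ j) j) {d : ℕ} {v : Fin n → F} (hv : v ∈ colSpan M d) (hv0 : v ≠ 0) :
    ∃ i : Fin n, (i : ℕ) < d ∧ v (σ i) ≠ 0 ∧ ∀ r, σ i < r → v r = 0 := by
  classical
  obtain ⟨c, hc, hcv⟩ := exists_coeff_of_mem_colSpan hv
  have hne : (Finset.univ.filter fun i => c i ≠ 0).Nonempty := by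
    by_contra h
    refine hv0 (funext fun r => ?_)
    rw [hcv]
    refine Finset.sum_eq_zero fun i _ => ?_
    have : c i = 0 := by
      by_contra hi
      exact h ⟨i, by simpa using hi⟩
    simp [this]
  obtain ⟨i, hi, hmax⟩ := Finset.exists_max_image _ (fun i => σ i) hne
  have hi : c i ≠ 0 := by simpa using hi
  have hmax : ∀ k, c k ≠ 0 → σ k ≤ σ i := fun k hk => hmax k (by simpa using hk)
  refine ⟨i, hc i hi, ?_, fun r hr => ?_⟩
  · rw [hcv, Finset.sum_eq_single i]
    · exact mul_ne_zero hi (hM i).1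
    · intro k _ hk
      by_cases h : c k = 0
      · simp [h]
      · rw [(hM k).2 _ (lt_of_le_of_ne (hmax k h) fun e => hk (σ.injective e)), mul_zero]
    · simp
  · rw [hcv]
    refine Finset.sum_eq_zero fun k _ => ?_
    by_cases h : c k = 0
    · simp [h]
    · rw [(hM k).2 _ ((hmax k h).trans_lt hr), mul_zero]

theorem exists_lt_perm_eq_of_colSpan_eq {M N : Matrix (Fin n) (Fin n) F}
    {σ τ : Equiv.Perm (Fin n)} (hM : ∀ j, IsPivot M (σ j) j) (hN : ∀ j, IsPivot N (τ j) j)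
    {d : ℕ} (h : colSpan M d = colSpan N d) {j : Fin n} (hj : (j : ℕ) < d) :
    ∃ i : Fin n, (i : ℕ) < d ∧ σ i = τ j := by
  have hne : Nᵀ j ≠ 0 := fun h0 => (hN j).1 (congrFun h0 (τ j))
  obtain ⟨i, hi, hp, hz⟩ :=
    exists_pivot_of_mem_colSpan hM (h ▸ col_mem_colSpan N hj) hne
  exact ⟨i, hi, IsPivot.row_unique (M := N) (j := j) ⟨hp, hz⟩ (hN j) rfl⟩

theorem finrank_colSpan {M : Matrix (Fin n) (Fin n) F} (h : colSpan M n = ⊤) {d : ℕ}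
    (hd : d ≤ n) : Module.finrank F (colSpan M d) = d := by
  have hli : LinearIndependent F (fun i : Fin n => Mᵀ i) := by
    refine linearIndependent_of_top_le_span_of_card_eq_finrank ?_ (by simp)
    rw [← h]
    exact colSpan_le fun j _ => Submodule.subset_span ⟨j, rfl⟩
  have h1 := finrank_span_eq_card
    (hli.comp (Subtype.val : {i : Fin n // (i : ℕ) < d} → Fin n) Subtype.val_injective)
  have h2 : colSpan M d = Submodule.span F (Set.range
      ((fun i : Fin n => Mᵀ i) ∘ (Subtype.val : {i : Fin n // (i : ℕ) < d} → Fin n))) := by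
    refine congrArg (Submodule.span F) (Set.ext fun x => ⟨?_, ?_⟩)
    · rintro ⟨i, hi, rfl⟩
      exact ⟨⟨i, hi⟩, rfl⟩
    · rintro ⟨i, rfl⟩
      exact ⟨i, i.2, rfl⟩
  rw [h2, h1, Fintype.card_subtype, Fin.card_filter_val_lt, min_eq_right hd]

theorem isMaximalFlag_colSpan {M : Matrix (Fin n) (Fin n) F} (hn : 2 ≤ n) (h : colSpan M n = ⊤) :
    IsMaximalFlag (colSpan M '' Set.Icc 1 (n - 1)) := by
  refine ⟨⟨(Set.finite_Icc _ _).image _, ⟨_, 1, ⟨le_rfl, by omega⟩, rfl⟩, ?_, ?_⟩, ?_⟩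
  · rintro _ ⟨a, -, rfl⟩ _ ⟨b, -, rfl⟩ -
    exact (le_total a b).imp (fun h => colSpan_mono M h) (fun h => colSpan_mono M h)
  · rintro _ ⟨a, ⟨h1, h2⟩, rfl⟩
    have hr := finrank_colSpan h (d := a) (by omega)
    constructor <;> intro e <;> rw [e] at hr
    · rw [finrank_bot] at hr
      omega
    · rw [finrank_top, Module.finrank_fin_fun] at hr
      omega
  · exact fun j h1 h2 => ⟨_, ⟨j, ⟨h1, h2⟩, rfl⟩, finrank_colSpan h (by omega)⟩

/-- Exchange columns `p` and `q` of `M`, then subtract the multiple of the new column `p` from the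
new column `q` for which the entry of the difference in row `r` vanishes when `M r q = 1`. -/
def exchangeCols (M : Matrix (Fin n) (Fin n) F) (p q r : Fin n) : Matrix (Fin n) (Fin n) F :=
  fun i j => if j = p then M i q else if j = q then M i p - M r p * M i q else M i j

theorem colSpan_exchangeCols (M : Matrix (Fin n) (Fin n) F) {p q : Fin n} (r : Fin n)
    (hpq : (p : ℕ) + 1 = q) {d : ℕ} (hd : d ≠ q) :
    colSpan (exchangeCols M p q r) d = colSpan M d := by
  have hne : q ≠ p := fun h => by simp [h] at hpq
  have hp : (exchangeCols M p q r)ᵀ p = Mᵀ q := by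
    ext i; simp [exchangeCols]
  have hq : (exchangeCols M p q r)ᵀ q = Mᵀ p - M r p • Mᵀ q := by
    ext i; simp [exchangeCols, hne]
  have ho : ∀ j, j ≠ p → j ≠ q → (exchangeCols M p q r)ᵀ j = Mᵀ j := by
    intro j h1 h2; ext i; simp [exchangeCols, h1, h2]
  refine le_antisymm (colSpan_le fun j hj => ?_) (colSpan_le fun j hj => ?_)
  · by_cases h1 : j = p
    · subst h1
      rw [hp]
      exact col_mem_colSpan M (by omega)
    by_cases h2 : j = q
    · subst h2
      rw [hq]
      exact sub_mem (col_mem_colSpan M (by omega))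
        (Submodule.smul_mem _ _ (col_mem_colSpan M (by omega)))
    · rw [ho j h1 h2]
      exact col_mem_colSpan M hj
  · by_cases h1 : j = p
    · subst h1
      have : Mᵀ j = (exchangeCols M j q r)ᵀ q + M r j • (exchangeCols M j q r)ᵀ j := by
        rw [hp, hq, sub_add_cancel]
      rw [this]
      exact add_mem (col_mem_colSpan _ (by omega))
        (Submodule.smul_mem _ _ (col_mem_colSpan _ (by omega)))
    by_cases h2 : j = q
    · subst h2
      rw [← hp]
      exact col_mem_colSpan _ (by omega)
    · rw [← ho j h1 h2]
      exact col_mem_colSpan _ hj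

theorem isPivot_exchangeCols {M : Matrix (Fin n) (Fin n) F} {σ : Equiv.Perm (Fin n)}
    (hM : ∀ j, IsPivot M (σ j) j) {p q : Fin n} (hpq : p < q) (hσ : σ q < σ p) (j : Fin n) :
    IsPivot (exchangeCols M p q (σ q)) ((Equiv.swap p q).trans σ j) j := by
  have hne : q ≠ p := hpq.ne'
  by_cases h1 : j = p
  · subst h1
    simpa [IsPivot, exchangeCols] using hM q
  by_cases h2 : j = q
  · subst h2
    have h0 : M (σ p) j = 0 := (hM j).2 _ hσ
    refine ⟨by simpa [exchangeCols, hne, h0] using (hM p).1, fun r hr => ?_⟩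
    have hr : σ p < r := by simpa using hr
    simp [exchangeCols, hne, (hM p).2 r hr, (hM j).2 r (hσ.trans hr)]
  · simpa [IsPivot, exchangeCols, h1, h2, Equiv.swap_apply_of_ne_of_ne h1 h2] using hM j

theorem exchangeCols_pivot_eq_one {M : Matrix (Fin n) (Fin n) F} {σ : Equiv.Perm (Fin n)}
    (hM : ∀ j, IsPivot M (σ j) j) (hone : ∀ j, M (σ j) j = 1)
    {p q : Fin n} (hpq : p < q) (hσ : σ q < σ p) (j : Fin n) :
    exchangeCols M p q (σ q) ((Equiv.swap p q).trans σ j) j = 1 := by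
  have hne : q ≠ p := hpq.ne'
  by_cases h1 : j = p
  · subst h1
    simpa [exchangeCols] using hone q
  by_cases h2 : j = q
  · subst h2
    simp [exchangeCols, hne, (hM j).2 _ hσ, hone]
  · simpa [exchangeCols, h1, h2, Equiv.swap_apply_of_ne_of_ne h1 h2] using hone j

theorem exchangeCols_right_of_pivot_eq_zero {M : Matrix (Fin n) (Fin n) F}
    {σ : Equiv.Perm (Fin n)} (hone : ∀ j, M (σ j) j = 1)
    (hzero : ∀ j k, j < k → M (σ j) k = 0)
    {p q : Fin n} (hpq : (p : ℕ) + 1 = q) {j k : Fin n} (hjk : j < k) :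
    exchangeCols M p q (σ q) ((Equiv.swap p q).trans σ j) k = 0 := by
  have hne : q ≠ p := fun h => by simp [h] at hpq
  by_cases h1 : j = p
  · subst h1
    by_cases h2 : k = q
    · subst h2
      simp [exchangeCols, hne, hone]
    · simp [exchangeCols, h2, hjk.ne', hzero q k (by omega)]
  by_cases h2 : j = q
  · subst h2
    have h3 : k ≠ p := by omega
    simp [exchangeCols, hjk.ne', h3, hzero p k (by omega)]
  · simp only [Equiv.trans_apply, Equiv.swap_apply_of_ne_of_ne h1 h2, exchangeCols]
    split_ifs with h3 h4
    · exact hzero j q (by omega)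
    · rw [hzero j p (by omega), hzero j q (by omega)]
      simp
    · exact hzero j k hjk

theorem isRep_exchangeCols {f : Set (Submodule F (Fin n → F))} {M : Matrix (Fin n) (Fin n) F}
    (hrep : IsRep f M) {σ : Equiv.Perm (Fin n)} (hM : ∀ j, IsPivot M (σ j) j)
    {p q : Fin n} (hpq : (p : ℕ) + 1 = q) (hσ : σ q < σ p) :
    IsRep (colSpan (exchangeCols M p q (σ q)) '' Set.Icc 1 (n - 1))
      (exchangeCols M p q (σ q)) := by
  have hlt : p < q := by omega
  have hone : ∀ j, M (σ j) j = 1 := fun j => hrep.2.2.1 _ _ (hM j)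
  have htop : colSpan (exchangeCols M p q (σ q)) n = ⊤ := by
    rw [colSpan_exchangeCols M _ hpq q.isLt.ne', hrep.2.1]
  have hpiv := isPivot_exchangeCols hM hlt hσ
  refine ⟨?_, htop, fun r j h => ?_, fun r j k h hjk => ?_⟩
  · rintro _ ⟨d, ⟨-, hd⟩, rfl⟩
    rw [finrank_colSpan htop (by omega)]
  · rw [h.row_unique (hpiv j) rfl]
    exact exchangeCols_pivot_eq_one hM hone hlt hσ j
  · rw [h.row_unique (hpiv j) rfl]
    exact exchangeCols_right_of_pivot_eq_zero hone
      (fun j k hjk => hrep.2.2.2 _ _ _ (hM j) hjk) hpq hjk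

theorem LexLt.asymm {σ τ : Equiv.Perm (Fin n)} (h : LexLt σ τ) : ¬ LexLt τ σ := by
  obtain ⟨i, hi, hlt⟩ := h
  rintro ⟨j, hj, hlt'⟩
  rcases lt_trichotomy i j with hij | rfl | hij
  · exact hlt.ne (hj i hij).symm
  · exact lt_asymm hlt hlt'
  · exact hlt'.ne (hi j hij).symm

theorem LexLt.ne {σ τ : Equiv.Perm (Fin n)} (h : LexLt σ τ) : σ ≠ τ := by
  rintro rfl
  exact h.asymm h

theorem lexLt_swap {σ : Equiv.Perm (Fin n)} {p q : Fin n} (hpq : p < q) (hσ : σ q < σ p) :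
    LexLt ((Equiv.swap p q).trans σ) σ := by
  refine ⟨p, fun i hi => ?_, by simpa using hσ⟩
  simp [Equiv.swap_apply_of_ne_of_ne hi.ne (hi.trans hpq).ne]

theorem exists_descent_of_lt {σ : Equiv.Perm (Fin n)} {j k : Fin n} (hjk : j ≤ k)
    (h : σ k < σ j) : ∃ t : ℕ, (j : ℕ) ≤ t ∧ t < k ∧ ¬ Ascent σ t := by
  by_contra! hasc
  have key : ∀ m (hm : m < n), (j : ℕ) ≤ m → m ≤ k → σ j ≤ σ ⟨m, hm⟩ := by
    intro m hm hjm
    induction m, hjm using Nat.le_induction with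
    | base => exact fun _ => le_rfl
    | succ m hjm ih =>
      intro hmk
      obtain ⟨_, hlt⟩ := hasc m hjm (by omega)
      exact (ih (by omega) (by omega)).trans hlt.le
  exact absurd h (not_lt.2 (key k k.isLt hjk le_rfl))

/-- A permutation is lexicographically least among those having the same sets of initial values
of each length that does not end at an ascent. -/
theorem eq_or_lexLt_of_descents {σ τ : Equiv.Perm (Fin n)}
    (h : ∀ d, 1 ≤ d → d < n → ¬ Ascent σ (d - 1) →
      ∀ j : Fin n, (j : ℕ) < d → ∃ i : Fin n, (i : ℕ) < d ∧ σ i = τ j) :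
    σ = τ ∨ LexLt σ τ := by
  by_cases hne : ∃ j, σ j ≠ τ j
  · right
    obtain ⟨j, hj, hmin⟩ := WellFounded.has_min (wellFounded_lt (α := Fin n)) {j | σ j ≠ τ j} hne
    have hmin : ∀ i, i < j → σ i = τ i := fun i hi => not_not.1 fun h' => hmin i h' hi
    refine ⟨j, hmin, lt_of_not_ge fun hle => ?_⟩
    have hlt : τ j < σ j := lt_of_le_of_ne hle (Ne.symm hj)
    obtain ⟨k, hk⟩ := σ.surjective (τ j)
    have hjk : j ≤ k := by
      by_contra! hkj
      exact hkj.ne (τ.injective ((hmin k hkj).symm.trans hk))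
    obtain ⟨t, hjt, htk, hdesc⟩ := exists_descent_of_lt hjk (hk ▸ hlt)
    obtain ⟨i, hi, hij⟩ := h (t + 1) (by omega) (by omega) (by simpa using hdesc) j (by omega)
    have : i = k := σ.injective (hij.trans hk.symm)
    omega
  · left
    push Not at hne
    exact Equiv.ext hne

/-- for a maximal flag `f = (V_1 ⊊ ⋯ ⊊ V_{n-1})` with label `σ` and a proper
subset `S ⊊ {1,…,n-1}`, the face of `f` obtained by deleting the subspaces `V_ℓ`, `ℓ ∈ S`,
lies in `X_σ` iff `σ(t) < σ(t+1)` for every `t ∈ S` (in 0-based indexing: `Ascent σ (t-1)`). -/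
theorem deleted_face_in_X_sigma_iff_ascents
    [Fintype F] (hn : 2 ≤ n)
    (f : Set (Submodule F (Fin n → F))) (hf : IsMaximalFlag f)
    (σ : Equiv.Perm (Fin n)) (hσ : IsLabel f σ)
    (S : Set ℕ) (hS : S ⊆ Set.Icc 1 (n - 1)) (hSne : S ≠ Set.Icc 1 (n - 1)) :
    IsMinlabel {V | V ∈ f ∧ Module.finrank F V ∉ S} σ ↔ ∀ t ∈ S, Ascent σ (t - 1) := by
  obtain ⟨M, hrep, hpiv⟩ := hσ
  constructor
  · rintro ⟨-, hmin⟩ t ht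
    obtain ⟨h1, h2⟩ := hS ht
    have htn : t - 1 + 1 < n := by omega
    by_contra hasc
    set p : Fin n := ⟨t - 1, by omega⟩
    set q : Fin n := ⟨t - 1 + 1, htn⟩
    have hpq : (p : ℕ) + 1 = q := rfl
    have hlt : p < q := by omega
    have hqt : (q : ℕ) = t := by simp only [q]; omega
    have hdesc : σ q < σ p :=
      lt_of_le_of_ne (not_lt.1 fun h => hasc ⟨htn, h⟩) fun e => hlt.ne (σ.injective e).symm
    have hrep' := isRep_exchangeCols hrep hpiv hpq hdesc
    have hlex := lexLt_swap hlt hdesc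
    have hsub : {V | V ∈ f ∧ Module.finrank F V ∉ S} ⊆
        colSpan (exchangeCols M p q (σ q)) '' Set.Icc 1 (n - 1) := by
      rintro V ⟨hV, hVS⟩
      have hbot : Module.finrank F V ≠ 0 := fun h =>
        (hf.1.2.2.2 V hV).1 (Submodule.finrank_eq_zero.1 h)
      have htop : Module.finrank F V < n := by
        simpa using Submodule.finrank_lt (hf.1.2.2.2 V hV).2
      refine ⟨Module.finrank F V, ⟨by omega, by omega⟩, ?_⟩
      rw [colSpan_exchangeCols M _ hpq fun h => hVS (by rwa [h, hqt]), hrep.1 V hV]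
    rcases hmin _ _ (isMaximalFlag_colSpan hn hrep'.2.1) hsub
      ⟨_, hrep', isPivot_exchangeCols hpiv hlt hdesc⟩ with h | h
    · exact hlex.ne h.symm
    · exact hlex.asymm h
  · intro hasc
    refine ⟨⟨f, hf, fun V hV => hV.1, M, hrep, hpiv⟩, ?_⟩
    rintro f' τ - hsub ⟨N, hrepN, hpivN⟩
    refine eq_or_lexLt_of_descents fun d h1 h2 hdesc j hj => ?_
    obtain ⟨V, hV, hd⟩ := hf.2 d h1 (by omega)
    have hdS : d ∉ S := fun h => hdesc (hasc d h)
    have hV' : V ∈ f' := hsub ⟨hV, hd ▸ hdS⟩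
    refine exists_lt_perm_eq_of_colSpan_eq hpiv hpivN ?_ hj
    rw [← hd, hrep.1 V hV, hrepN.1 V hV']
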